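/- Let d ≥ 3, a ≥ 1, and x, y ∈ ℤ^d with |x - y| > 7a, and suppose the ball V_a(y) ⊂ V_L. Then there exists a constant C > 0 (independent of a, L, x, y) such that the probability that simple random walk started at x hits V_a(y) before exiting V_L satisfies P_x(T_{V_a(y)} < τ_L) ≤ C · a^{d-2} · max{a, d_L(y)} · max{1, d_L(x)} / |x-y|^d. -/

import Mathlib

open MeasureTheory

/-- Euclidean norm of a lattice point in `ℤ^d`. -/
noncomputable def znorm {d : ℕ} (x : Fin d → ℤ) : ℝ := Real.sqrt (∑ i, ((x i : ℝ)) ^ 2)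

/-- A (time-homogeneous) Markov chain: a family of path-space laws `P x` which are
probability measures started at `x` and satisfy the Markov property. -/
def IsMarkovChain {S : Type*} [MeasurableSpace S]
    (P : S → Measure (ℕ → S)) : Prop :=
  (∀ x, IsProbabilityMeasure (P x)) ∧
  (∀ x, P x {ω | ω 0 = x} = 1) ∧
  (∀ (x : S) (n : ℕ) (A B : Set (ℕ → S)), MeasurableSet A → MeasurableSet B →
    (∀ ω ω' : ℕ → S, (∀ k ≤ n, ω k = ω' k) → (ω ∈ A ↔ ω' ∈ A)) →
    P x (A ∩ {ω | (fun k => ω (n + k)) ∈ B}) = ∫⁻ ω in A, P (ω n) B ∂(P x))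

/-- Simple random walk on `ℤ^d`. -/
def IsSRW (d : ℕ) (P : (Fin d → ℤ) → Measure (ℕ → Fin d → ℤ)) : Prop :=
  IsMarkovChain P ∧
  ∀ x y : Fin d → ℤ,
    P x {ω | ω 1 = y} = if znorm (y - x) = 1 then ENNReal.ofReal (1 / (2 * d)) else 0

theorem exists_abs_one_add_rpow_sub_cubic_le (p : ℝ) :
    ∃ c C δ : ℝ, 0 ≤ C ∧ 0 < δ ∧ ∀ η : ℝ, |η| ≤ δ →
      |(1 + η) ^ (-p) - (1 - p * η + p * (p + 1) / 2 * η ^ 2 + c * η ^ 3)| ≤ C * η ^ 4 := by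
  have h := (Real.one_add_rpow_hasFPowerSeriesAt_zero (a := -p)).isBigO_sub_partialSum_pow 4
  obtain ⟨C, hC, hb⟩ := h.exists_nonneg
  rw [Asymptotics.IsBigOWith, Metric.eventually_nhds_iff] at hb
  obtain ⟨ε, hε, hb⟩ := hb
  have hchoose : Ring.choose (-p) 2 = p * (p + 1) / 2 := by
    have := Ring.descPochhammer_eq_factorial_smul_choose (-p) 2
    rw [Polynomial.descPochhammer_smeval_eq_ascPochhammer] at this
    rw [Polynomial.ascPochhammer_smeval_eq_eval] at this
    simp [ascPochhammer_succ_right] at this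
    linarith
  refine ⟨Ring.choose (-p) 3, C, ε / 2, hC, by positivity, fun η hη => ?_⟩
  have := @hb η (by simp; linarith)
  simp [FormalMultilinearSeries.partialSum, Finset.sum_range_succ, binomialSeries] at this
  rw [hchoose, pow_abs, abs_of_nonneg (by positivity : (0 : ℝ) ≤ η ^ 4)] at this
  convert this using 2
  ring

theorem norm_add_single_sq {d : ℕ} (v : EuclideanSpace ℝ (Fin d)) (i : Fin d) (t : ℝ) :
    ‖v + EuclideanSpace.single i t‖ ^ 2 = ‖v‖ ^ 2 + 2 * t * v i + t ^ 2 := by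
  rw [norm_add_sq_real, EuclideanSpace.inner_single_right]
  simp
  ring

theorem exists_abs_rpow_pair_le (p : ℝ) :
    ∃ C s₀ : ℝ, 0 ≤ C ∧ 1 ≤ s₀ ∧ ∀ s t : ℝ, s₀ ≤ s → t ^ 2 ≤ s →
      |(s + 2 * t + 1) ^ (-p) + (s - 2 * t + 1) ^ (-p) -
        s ^ (-p) * (2 - 2 * p / s + 4 * p * (p + 1) * t ^ 2 / s ^ 2)| ≤
        C * (s ^ (-p) / s ^ 2) := by
  obtain ⟨c, C, δ, hC, hδ, h⟩ := exists_abs_one_add_rpow_sub_cubic_le p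
  refine ⟨162 * C + |p * (p + 1)| + 26 * |c|, max 1 (9 / min δ (1/2) ^ 2), by positivity,
    le_max_left _ _, ?_⟩
  intro s t hs hts
  have hm : 0 < min δ (1/2) := by positivity
  have hs1 : 1 ≤ s := (le_max_left _ _).trans hs
  have hs0 : 0 < s := by linarith
  have hs2 : 9 / min δ (1/2) ^ 2 ≤ s := (le_max_right _ _).trans hs
  have hsq : ∀ t : ℝ, t ^ 2 ≤ s → (2 * t + 1) ^ 2 ≤ 9 * s := by
    intro t ht
    nlinarith [sq_nonneg (t - 1)]
  have key : ∀ t : ℝ, t ^ 2 ≤ s →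
      ((2 * t + 1) / s) ^ 2 ≤ 9 / s ∧ |(2 * t + 1) / s| ≤ min δ (1/2) := by
    intro t ht
    have h1 : ((2 * t + 1) / s) ^ 2 ≤ 9 / s := by
      rw [div_pow, div_le_div_iff₀ (by positivity) hs0]
      nlinarith [hsq t ht]
    refine ⟨h1, abs_le_of_sq_le_sq (h1.trans ?_) hm.le⟩
    rw [div_le_iff₀ hs0]
    rw [div_le_iff₀ (by positivity)] at hs2
    linarith
  have est : ∀ t : ℝ, t ^ 2 ≤ s → (s + 2 * t + 1) ^ (-p) = s ^ (-p) * (1 + (2 * t + 1) / s) ^ (-p) ∧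
      |(1 + (2 * t + 1) / s) ^ (-p) - (1 - p * ((2 * t + 1) / s) +
        p * (p + 1) / 2 * ((2 * t + 1) / s) ^ 2 + c * ((2 * t + 1) / s) ^ 3)| ≤ C * (81 / s ^ 2) := by
    intro t ht
    obtain ⟨h1, h2⟩ := key t ht
    constructor
    · rw [← Real.mul_rpow hs0.le]
      · congr 1; field_simp; ring
      · have := (abs_le.1 h2).1
        have := min_le_right δ (1/2)
        linarith
    · refine (h _ (h2.trans (min_le_left _ _))).trans ?_
      gcongr
      calc ((2 * t + 1) / s) ^ 4 = (((2 * t + 1) / s) ^ 2) ^ 2 := by ring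
        _ ≤ (9 / s) ^ 2 := by gcongr
        _ = 81 / s ^ 2 := by ring
  obtain ⟨e1, b1⟩ := est t hts
  obtain ⟨e2, b2⟩ := est (-t) (by simpa using hts)
  have e3 : s - 2 * t + 1 = s + 2 * (-t) + 1 := by ring
  have hres : |p * (p + 1) / s ^ 2 + c * (2 / s ^ 3 + 24 * t ^ 2 / s ^ 3)| ≤
      (|p * (p + 1)| + 26 * |c|) / s ^ 2 := by
    have h26 : 2 / s ^ 3 + 24 * t ^ 2 / s ^ 3 ≤ 26 / s ^ 2 := by
      rw [← add_div, div_le_div_iff₀ (by positivity) (by positivity)]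
      have : 2 + 24 * t ^ 2 ≤ 26 * s := by linarith
      nlinarith [pow_pos hs0 2]
    refine (abs_add_le _ _).trans ?_
    rw [abs_div, abs_mul c, abs_of_nonneg (by positivity : 0 ≤ s ^ 2),
      abs_of_nonneg (by positivity : 0 ≤ 2 / s ^ 3 + 24 * t ^ 2 / s ^ 3), add_div]
    have := mul_le_mul_of_nonneg_left h26 (abs_nonneg c)
    calc _ ≤ |p * (p + 1)| / s ^ 2 + |c| * (26 / s ^ 2) := by gcongr
      _ = _ := by ring
  have hsum : (1 + (2 * t + 1) / s) ^ (-p) + (1 + (2 * -t + 1) / s) ^ (-p) -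
      (2 - 2 * p / s + 4 * p * (p + 1) * t ^ 2 / s ^ 2) =
      ((1 + (2 * t + 1) / s) ^ (-p) - (1 - p * ((2 * t + 1) / s) +
        p * (p + 1) / 2 * ((2 * t + 1) / s) ^ 2 + c * ((2 * t + 1) / s) ^ 3)) +
      ((1 + (2 * -t + 1) / s) ^ (-p) - (1 - p * ((2 * -t + 1) / s) +
        p * (p + 1) / 2 * ((2 * -t + 1) / s) ^ 2 + c * ((2 * -t + 1) / s) ^ 3)) +
      (p * (p + 1) / s ^ 2 + c * (2 / s ^ 3 + 24 * t ^ 2 / s ^ 3)) := by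
    field_simp
    ring
  rw [e3, e1, e2, ← mul_add, ← mul_sub, abs_mul, abs_of_nonneg (Real.rpow_nonneg hs0.le _), hsum]
  calc s ^ (-p) * _ ≤ s ^ (-p) * (C * (81 / s ^ 2) + C * (81 / s ^ 2) +
        (|p * (p + 1)| + 26 * |c|) / s ^ 2) := by
        gcongr
        exact (abs_add_three _ _ _).trans (by gcongr)
    _ = _ := by ring

theorem exists_abs_laplacian_rpow_le (d : ℕ) (p : ℝ) :
    ∃ C s₀ : ℝ, 0 ≤ C ∧ 1 ≤ s₀ ∧ ∀ v : EuclideanSpace ℝ (Fin d), s₀ ≤ ‖v‖ ^ 2 →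
      |(∑ i, ((‖v + EuclideanSpace.single i 1‖ ^ 2) ^ (-p) +
          (‖v + EuclideanSpace.single i (-1)‖ ^ 2) ^ (-p)))
        - 2 * d * (‖v‖ ^ 2) ^ (-p) - 2 * p * (2 * p + 2 - d) * (‖v‖ ^ 2) ^ (-(p + 1))| ≤
        C * (‖v‖ ^ 2) ^ (-(p + 2)) := by
  obtain ⟨C, s₀, hC, hs₀, h⟩ := exists_abs_rpow_pair_le p
  refine ⟨d * C, s₀, by positivity, hs₀, fun v hv => ?_⟩
  have hvi : ∑ i, v i ^ 2 = ‖v‖ ^ 2 := (EuclideanSpace.real_norm_sq_eq v).symm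
  simp only [norm_add_single_sq]
  generalize ‖v‖ ^ 2 = s at hv hvi
  have hs : 0 < s := by linarith
  have h1 : s ^ (-(p + 1)) = s ^ (-p) / s := by
    rw [← Real.rpow_sub_one hs.ne']; congr 1; ring
  have h2 : s ^ (-(p + 2)) = s ^ (-p) / s ^ 2 := by
    rw [← Real.rpow_natCast s 2, ← Real.rpow_sub hs]; congr 1; push_cast; ring
  have hmain : 2 * d * s ^ (-p) + 2 * p * (2 * p + 2 - d) * s ^ (-(p + 1)) =
      ∑ i, s ^ (-p) * (2 - 2 * p / s + 4 * p * (p + 1) * v i ^ 2 / s ^ 2) := by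
    rw [← Finset.mul_sum, Finset.sum_add_distrib, ← Finset.sum_div, ← Finset.mul_sum, hvi, h1]
    simp
    field_simp
    ring
  rw [sub_sub, hmain, ← Finset.sum_sub_distrib, h2]
  refine (Finset.abs_sum_le_sum_abs _ _).trans ?_
  calc _ ≤ ∑ _i : Fin d, C * (s ^ (-p) / s ^ 2) := by
        refine Finset.sum_le_sum fun i _ => ?_
        rw [show s + 2 * 1 * v i + 1 ^ 2 = s + 2 * v i + 1 by ring,
          show s + 2 * (-1) * v i + (-1) ^ 2 = s - 2 * v i + 1 by ring]
        exact h s (v i) hv (hvi ▸ Finset.single_le_sum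
          (f := fun i => v i ^ 2) (fun i _ => sq_nonneg _) (Finset.mem_univ i))
    _ = _ := by simp; ring

/-- The sum of a function over the `2d` lattice neighbours of a point. -/
noncomputable def nbrSum {d : ℕ} (H : EuclideanSpace ℝ (Fin d) → ℝ)
    (v : EuclideanSpace ℝ (Fin d)) : ℝ :=
  ∑ i, (H (v + EuclideanSpace.single i 1) + H (v + EuclideanSpace.single i (-1)))

theorem nbrSum_comp_sub {d : ℕ} (H : EuclideanSpace ℝ (Fin d) → ℝ)
    (v y : EuclideanSpace ℝ (Fin d)) :
    nbrSum (fun z => H (z - y)) v = nbrSum H (v - y) := by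
  simp only [nbrSum, sub_add_eq_add_sub]

theorem nbrSum_add {d : ℕ} (G H : EuclideanSpace ℝ (Fin d) → ℝ)
    (v : EuclideanSpace ℝ (Fin d)) :
    nbrSum (fun z => G z + H z) v = nbrSum G v + nbrSum H v := by
  simp only [nbrSum, ← Finset.sum_add_distrib]
  exact Finset.sum_congr rfl fun i _ => by ring

theorem nbrSum_const_mul {d : ℕ} (c : ℝ) (H : EuclideanSpace ℝ (Fin d) → ℝ)
    (v : EuclideanSpace ℝ (Fin d)) :
    nbrSum (fun z => c * H z) v = c * nbrSum H v := by
  simp only [nbrSum, Finset.mul_sum, mul_add]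

theorem nbrSum_sub {d : ℕ} (G H : EuclideanSpace ℝ (Fin d) → ℝ)
    (v : EuclideanSpace ℝ (Fin d)) :
    nbrSum (fun z => G z - H z) v = nbrSum G v - nbrSum H v := by
  simp only [nbrSum, ← Finset.sum_sub_distrib]
  exact Finset.sum_congr rfl fun i _ => by ring

theorem exists_corrected_newton {d : ℕ} (hd : 3 ≤ d) (p : ℝ) (hp : 2 * p + 2 = d) :
    ∃ c s₀ : ℝ, 0 ≤ c ∧ 1 ≤ s₀ ∧ ∀ v : EuclideanSpace ℝ (Fin d), s₀ ≤ ‖v‖ ^ 2 →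
      nbrSum (fun w => (‖w‖ ^ 2) ^ (-p) - c * (‖w‖ ^ 2) ^ (-(p + 1))) v ≤
        2 * d * ((‖v‖ ^ 2) ^ (-p) - c * (‖v‖ ^ 2) ^ (-(p + 1))) ∧
      2 * d * ((‖v‖ ^ 2) ^ (-p) + c * (‖v‖ ^ 2) ^ (-(p + 1))) ≤
        nbrSum (fun w => (‖w‖ ^ 2) ^ (-p) + c * (‖w‖ ^ 2) ^ (-(p + 1))) v := by
  obtain ⟨C₀, t₀, hC₀, ht₀, h₀⟩ := exists_abs_laplacian_rpow_le d p
  obtain ⟨C₁, t₁, hC₁, ht₁, h₁⟩ := exists_abs_laplacian_rpow_le d (p + 1)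
  refine ⟨C₀, max t₀ (max t₁ C₁), hC₀, ht₀.trans (le_max_left _ _), fun v hv => ?_⟩
  simp only [max_le_iff] at hv
  have a₀ := h₀ v hv.1
  have a₁ := h₁ v hv.2.1
  rw [nbrSum_sub, nbrSum_add, nbrSum_const_mul]
  simp only [nbrSum]
  generalize ‖v‖ ^ 2 = s at *
  have hs : 0 < s := by linarith
  have hd' : (3 : ℝ) ≤ d := by exact_mod_cast hd
  have e1 : 2 * p * (2 * p + 2 - d) = 0 := by rw [hp]; ring
  have e2 : 2 * (p + 1) * (2 * (p + 1) + 2 - d) = 2 * d := by rw [← hp]; ring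
  have e3 : s ^ (-(p + 1 + 2)) = s ^ (-(p + 2)) / s := by
    rw [← Real.rpow_sub_one hs.ne']; congr 1; ring
  have e4 : C₁ * s ^ (-(p + 1 + 2)) ≤ s ^ (-(p + 2)) := by
    rw [e3, ← mul_div_assoc, div_le_iff₀ hs, mul_comm]
    exact mul_le_mul_of_nonneg_left hv.2.2 (Real.rpow_nonneg hs.le _)
  have e5 : -(p + 1 + 1) = -(p + 2) := by ring
  rw [e1] at a₀
  rw [e2, e5] at a₁
  rw [abs_le] at a₀ a₁
  have hpos := Real.rpow_nonneg hs.le (-(p + 2))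
  have b := mul_le_mul_of_nonneg_left (a₁.1) hC₀
  have b2 := mul_le_mul_of_nonneg_left e4 hC₀
  have b3 := mul_nonneg (mul_nonneg hC₀ hpos) (by linarith : (0 : ℝ) ≤ d - 1)
  constructor <;> nlinarith

theorem corrected_rpow_le {p c s T t : ℝ} (hp : 1 / 2 ≤ p) (hc : 0 ≤ c) (hs : 0 < s)
    (hT : 0 < T) (ht : s + T ≤ t) :
    t ^ (-p) + c * t ^ (-(p + 1)) ≤ s ^ (-p) * (√(s / (s + T)) * (1 + c / s)) := by
  have h1 : t ^ (-p) ≤ (s + T) ^ (-p) :=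
    Real.rpow_le_rpow_of_nonpos (by linarith) ht (by linarith)
  have h2 : t ^ (-(p + 1)) ≤ t ^ (-p) / s := by
    rw [show -(p + 1) = -p - 1 by ring, Real.rpow_sub_one (by linarith)]
    have : 0 ≤ t ^ (-p) := Real.rpow_nonneg (by linarith) _
    gcongr
    linarith
  have h3 : (s + T) ^ (-p) = s ^ (-p) * (s / (s + T)) ^ p := by
    rw [Real.div_rpow hs.le (by linarith), Real.rpow_neg hs.le, Real.rpow_neg (by linarith)]
    have := Real.rpow_pos_of_pos hs p
    field_simp
  have h4 : (s / (s + T)) ^ p ≤ √(s / (s + T)) := by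
    rw [Real.sqrt_eq_rpow]
    refine Real.rpow_le_rpow_of_exponent_ge (by positivity) ?_ hp
    rw [div_le_one (by linarith)]
    linarith
  have h5 := Real.rpow_pos_of_pos hs (-p)
  calc t ^ (-p) + c * t ^ (-(p + 1)) ≤ t ^ (-p) + c * (t ^ (-p) / s) := by gcongr
    _ = t ^ (-p) * (1 + c / s) := by ring
    _ ≤ (s ^ (-p) * √(s / (s + T))) * (1 + c / s) := by
        gcongr
        rw [h3] at h1
        exact h1.trans (by gcongr)
    _ = _ := by ring

theorem corrected_rpow_sub_nonneg {p c s T t : ℝ} (hp : 1 / 2 ≤ p) (hc : 0 ≤ c) (hs : 0 < s)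
    (hT : 0 < T) (ht : s + T ≤ t) (hcs : 8 * c ≤ s) (hcT : 8 * c ≤ T) :
    0 ≤ (s ^ (-p) - c * s ^ (-(p + 1))) - (t ^ (-p) + c * t ^ (-(p + 1))) := by
  have h := corrected_rpow_le hp hc hs hT ht
  have h5 := Real.rpow_pos_of_pos hs (-p)
  have h6 : s ^ (-(p + 1)) = s ^ (-p) / s := by
    rw [show -(p + 1) = -p - 1 by ring, Real.rpow_sub_one hs.ne']
  have h7 : √(s / (s + T)) ≤ 1 - 2 * (c / s) := by
    have hcs' : c / s ≤ 1 / 8 := by rw [div_le_iff₀ hs]; linarith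
    refine Real.sqrt_le_iff.2 ⟨by linarith, ?_⟩
    have : s / (s + T) ≤ 1 - 4 * (c / s) := by
      rw [div_le_iff₀ (by linarith), ← sub_nonneg]
      have : (1 - 4 * (c / s)) * (s + T) - s = ((T - 4 * c) * s - 4 * c * T) / s := by
        field_simp; ring
      rw [this]
      refine div_nonneg ?_ hs.le
      nlinarith
    nlinarith [sq_nonneg (c / s)]
  have h8 : √(s / (s + T)) * (1 + c / s) ≤ 1 - c / s := by
    have : 0 ≤ c / s := by positivity
    calc _ ≤ (1 - 2 * (c / s)) * (1 + c / s) := by gcongr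
      _ ≤ _ := by nlinarith
  have h9 := mul_le_mul_of_nonneg_left h8 h5.le
  rw [h6]
  have : c * (s ^ (-p) / s) = s ^ (-p) * (c / s) := by ring
  rw [this]
  linarith

theorem quarter_rpow_le_corrected_sub {p c s T t : ℝ} (hp : 1 / 2 ≤ p) (hc : 0 ≤ c) (hs : 0 < s)
    (hT : 0 < T) (ht : s + T ≤ t) (hcs : 8 * c ≤ s) (hsT : 15 * s ≤ T) :
    1 / 4 * s ^ (-p) ≤ (s ^ (-p) - c * s ^ (-(p + 1))) - (t ^ (-p) + c * t ^ (-(p + 1))) := by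
  have h := corrected_rpow_le hp hc hs hT ht
  have h5 := Real.rpow_pos_of_pos hs (-p)
  have h6 : s ^ (-(p + 1)) = s ^ (-p) / s := by
    rw [show -(p + 1) = -p - 1 by ring, Real.rpow_sub_one hs.ne']
  have hcs' : c / s ≤ 1 / 8 := by rw [div_le_iff₀ hs]; linarith
  have h0 : 0 ≤ c / s := by positivity
  have h7 : √(s / (s + T)) ≤ 1 / 4 := by
    refine Real.sqrt_le_iff.2 ⟨by norm_num, ?_⟩
    rw [div_le_iff₀ (by linarith)]
    linarith
  have h8 : √(s / (s + T)) * (1 + c / s) ≤ 3 / 4 - c / s := by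
    calc _ ≤ 1 / 4 * (1 + c / s) := by gcongr
      _ ≤ _ := by linarith
  have h9 := mul_le_mul_of_nonneg_left h8 h5.le
  rw [h6]
  have : c * (s ^ (-p) / s) = s ^ (-p) * (c / s) := by ring
  rw [this]
  linarith

theorem inv_pow_sub_inv_pow_le {r l : ℝ} (m : ℕ) (hr : 0 < r) (hl : 0 ≤ l) :
    (r ^ m)⁻¹ - ((r + l) ^ m)⁻¹ ≤ m * l / r ^ (m + 1) := by
  have hb := one_add_mul_le_pow (a := -(l / (r + l))) (by
    have : l / (r + l) ≤ 1 := by rw [div_le_one (by linarith)]; linarith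
    linarith) m
  have e : 1 + -(l / (r + l)) = r / (r + l) := by field_simp; ring
  rw [e, div_pow] at hb
  have hl' : l / (r + l) ≤ l / r := by gcongr; linarith
  have h1 : 1 - r ^ m / (r + l) ^ m ≤ m * (l / r) := by
    have := mul_le_mul_of_nonneg_left hl' (Nat.cast_nonneg (α := ℝ) m)
    linarith
  calc (r ^ m)⁻¹ - ((r + l) ^ m)⁻¹ = (r ^ m)⁻¹ * (1 - r ^ m / (r + l) ^ m) := by
        field_simp
    _ ≤ (r ^ m)⁻¹ * (m * (l / r)) := by gcongr
    _ = _ := by field_simp; ring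

theorem exists_unit_inner_eq_norm {d : ℕ} (hd : 0 < d) (y : EuclideanSpace ℝ (Fin d)) :
    ∃ e : EuclideanSpace ℝ (Fin d), ‖e‖ = 1 ∧ inner ℝ y e = ‖y‖ := by
  by_cases hy : y = 0
  · exact ⟨EuclideanSpace.single ⟨0, hd⟩ 1, by simp, by simp [hy]⟩
  · refine ⟨‖y‖⁻¹ • y, norm_smul_inv_norm hy, ?_⟩
    rw [inner_smul_right, real_inner_self_eq_norm_sq]
    field_simp

/-- A superharmonic barrier of dipole type: it controls the probability of hitting a ball around
`y` before leaving the ball of radius `L`, when `y` is close to the boundary. -/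
theorem exists_dipole_barrier {d : ℕ} (hd : 3 ≤ d) :
    ∃ r₀ K : ℝ, 2 ≤ r₀ ∧ 0 < K ∧ ∀ (a D L : ℝ) (y : EuclideanSpace ℝ (Fin d)),
      1 ≤ a → a ≤ D → L - ‖y‖ ≤ D → ∃ F : EuclideanSpace ℝ (Fin d) → ℝ,
        (∀ z, ‖z‖ ≤ L → r₀ * a < ‖z - y‖ → nbrSum F z ≤ 2 * d * F z) ∧
        (∀ z, ‖z‖ ≤ L + 1 → r₀ * a - 1 ≤ ‖z - y‖ → 0 ≤ F z) ∧
        (∀ z, ‖z‖ ≤ L + 1 → r₀ * a - 1 ≤ ‖z - y‖ → ‖z - y‖ ≤ r₀ * a → 1 ≤ F z) ∧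
        (∀ z, ‖z‖ ≤ L + 1 → r₀ * a - 1 ≤ ‖z - y‖ →
          F z ≤ K * a ^ (d - 2) * D / ‖z - y‖ ^ (d - 1)) := by
  obtain ⟨m, rfl⟩ : ∃ m, d = m + 3 := ⟨d - 3, by omega⟩
  set p : ℝ := (m + 1) / 2 with hp
  have hp2 : 1 / 2 ≤ p := by
    have : (0 : ℝ) ≤ m := Nat.cast_nonneg m
    rw [hp]; linarith
  obtain ⟨c, s₀, hc, hs₀, hN⟩ := exists_corrected_newton (d := m + 3) hd p
    (by rw [hp]; push_cast; ring)
  set r₀ : ℝ := 2 + s₀ + 8 * c with hr₀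
  have hr2 : 2 ≤ r₀ := by linarith
  refine ⟨r₀, 4 * r₀ ^ (m + 1) * ((m + 1 : ℕ) * (6 * r₀)), hr2, by positivity, ?_⟩
  intro a D L y ha haD hLD
  obtain ⟨e, he, hye⟩ := exists_unit_inner_eq_norm (by omega) y
  set l : ℝ := 6 * r₀ * D with hl
  have hD : 1 ≤ D := ha.trans haD
  have hl0 : 0 < l := by positivity
  set T : ℝ := l ^ 2 / 2 with hT
  have hT0 : 0 < T := by positivity
  have hrpow : ∀ r : ℝ, 0 ≤ r → (r ^ 2) ^ (-p) = (r ^ (m + 1))⁻¹ := by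
    intro r hr
    rw [Real.rpow_neg (by positivity), ← Real.rpow_natCast r 2, ← Real.rpow_mul hr,
      ← Real.rpow_natCast r (m + 1)]
    congr 2
    rw [hp]; push_cast; ring
  -- squared distances to the pole and to its image
  have hdist : ∀ z : EuclideanSpace ℝ (Fin (m + 3)), ‖z‖ ≤ L + 1 →
      ‖z - y‖ ^ 2 + T ≤ ‖z - (y + l • e)‖ ^ 2 := by
    intro z hz
    have hze : inner ℝ z e ≤ L + 1 := by
      have := real_inner_le_norm z e
      rw [he, mul_one] at this
      linarith
    rw [← sub_sub, norm_sub_sq_real (z - y) (l • e), inner_smul_right, inner_sub_left, hye,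
      norm_smul, he, mul_one, Real.norm_eq_abs, sq_abs]
    have h1 : inner ℝ z e - ‖y‖ ≤ 2 * D := by linarith
    have h2 : l * (inner ℝ z e - ‖y‖) ≤ l * (2 * D) := by gcongr
    have h3 : 12 * D ≤ l := by rw [hl]; nlinarith
    have h4 : l * (12 * D) ≤ l * l := by gcongr
    nlinarith
  have hfar : ∀ z : EuclideanSpace ℝ (Fin (m + 3)), r₀ * a - 1 ≤ ‖z - y‖ →
      s₀ + 8 * c ≤ ‖z - y‖ ^ 2 := by
    intro z hz
    have h1 : 1 + s₀ + 8 * c ≤ ‖z - y‖ := by nlinarith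
    nlinarith
  have hcT : 8 * c ≤ T := by
    have : r₀ ≤ l := by rw [hl]; nlinarith
    nlinarith
  set f : EuclideanSpace ℝ (Fin (m + 3)) → ℝ :=
    fun w => (‖w‖ ^ 2) ^ (-p) - c * (‖w‖ ^ 2) ^ (-(p + 1)) with hf
  set g : EuclideanSpace ℝ (Fin (m + 3)) → ℝ :=
    fun w => (‖w‖ ^ 2) ^ (-p) + c * (‖w‖ ^ 2) ^ (-(p + 1)) with hg
  have hpos : 0 < 4 * (r₀ * a) ^ (m + 1) := by positivity
  refine ⟨fun z => 4 * (r₀ * a) ^ (m + 1) * (f (z - y) - g (z - (y + l • e))), ?_, ?_, ?_, ?_⟩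
  · intro z hz hza
    have h1 := hfar z (by linarith)
    have h2 := hdist z (by linarith)
    have h3 := (hN (z - y) (by linarith)).1
    have h4 := (hN (z - (y + l • e)) (by linarith)).2
    rw [nbrSum_const_mul, nbrSum_sub, nbrSum_comp_sub, nbrSum_comp_sub]
    rw [mul_left_comm]
    gcongr
    rw [mul_sub]
    exact sub_le_sub h3 h4
  · intro z hz hza
    have h1 := hfar z hza
    exact mul_nonneg hpos.le (corrected_rpow_sub_nonneg hp2 hc (by linarith) hT0 (hdist z hz)
      (by linarith) hcT)
  · intro z hz hza hza'
    have h1 := hfar z hza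
    have h2 : ‖z - y‖ ^ 2 ≤ (r₀ * a) ^ 2 := by gcongr
    have h3 : 15 * ‖z - y‖ ^ 2 ≤ T := by
      have : (6 * (r₀ * a)) ^ 2 ≤ l ^ 2 := by
        rw [hl, mul_assoc 6]
        gcongr
      nlinarith
    have h4 := quarter_rpow_le_corrected_sub hp2 hc (by linarith) hT0 (hdist z hz)
      (by linarith) h3
    have h5 : ((r₀ * a) ^ (m + 1))⁻¹ ≤ (‖z - y‖ ^ 2) ^ (-p) := by
      rw [hrpow _ (norm_nonneg _)]
      have : 0 < ‖z - y‖ := by nlinarith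
      gcongr
    calc (1 : ℝ) = 4 * (r₀ * a) ^ (m + 1) * (1 / 4 * ((r₀ * a) ^ (m + 1))⁻¹) := by field_simp
      _ ≤ 4 * (r₀ * a) ^ (m + 1) * (1 / 4 * (‖z - y‖ ^ 2) ^ (-p)) := by gcongr
      _ ≤ _ := mul_le_mul_of_nonneg_left h4 hpos.le
  · intro z hz hza
    have hr : 0 < ‖z - y‖ := by nlinarith
    have h1 : f (z - y) - g (z - (y + l • e)) ≤ (m + 1 : ℕ) * l / ‖z - y‖ ^ (m + 2) := by
      refine le_trans ?_ (inv_pow_sub_inv_pow_le (m + 1) hr hl0.le)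
      have h2 : ‖z - (y + l • e)‖ ≤ ‖z - y‖ + l := by
        rw [← sub_sub]
        refine (norm_sub_le _ _).trans ?_
        rw [norm_smul, he, mul_one, Real.norm_of_nonneg hl0.le]
      have h3 : 0 < ‖z - (y + l • e)‖ := by
        have := hdist z hz
        by_contra! h
        have : ‖z - (y + l • e)‖ = 0 := le_antisymm h (norm_nonneg _)
        nlinarith
      have h4 : ((‖z - y‖ + l) ^ (m + 1))⁻¹ ≤ (‖z - (y + l • e)‖ ^ 2) ^ (-p) := by
        rw [hrpow _ h3.le]
        gcongr
      have h5 : 0 ≤ c * (‖z - y‖ ^ 2) ^ (-(p + 1)) := by positivity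
      have h6 : 0 ≤ c * (‖z - (y + l • e)‖ ^ 2) ^ (-(p + 1)) := by positivity
      rw [← hrpow _ hr.le]
      simp only [hf, hg]
      linarith
    calc _ ≤ 4 * (r₀ * a) ^ (m + 1) * ((m + 1 : ℕ) * l / ‖z - y‖ ^ (m + 2)) :=
        mul_le_mul_of_nonneg_left h1 hpos.le
      _ = _ := by
        simp only [hl, show m + 3 - 2 = m + 1 by omega, show m + 3 - 1 = m + 2 by omega]
        rw [mul_pow]
        ring

/-- A harmonic quadratic polynomial that grows linearly in the distance to the boundary of the
ball of radius `L + 1` near `x` and dominates the squared distance to `x`. -/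
theorem exists_quadratic_barrier {d : ℕ} (hd : 0 < d) {L R : ℝ} (x : EuclideanSpace ℝ (Fin d))
    (hx : ‖x‖ ≤ L + 1) (hxR : L + 1 - ‖x‖ ≤ R) :
    ∃ b : EuclideanSpace ℝ (Fin d) → ℝ,
      (∀ z, nbrSum b z = 2 * d * b z) ∧
      (∀ z, ‖z‖ ≤ L + 1 → ‖z - x‖ ≤ R → ‖z - x‖ ^ 2 ≤ b z) ∧
      b x ≤ 3 * d * R * (L + 1 - ‖x‖) := by
  obtain ⟨e, he, hxe⟩ := exists_unit_inner_eq_norm hd x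
  have hd0 : (0 : ℝ) ≤ d := Nat.cast_nonneg d
  refine ⟨fun z => 3 * d * R * (L + 1 - inner ℝ z e) - d * (L + 1 - inner ℝ z e) ^ 2
    + ‖z - x‖ ^ 2, ?_, ?_, ?_⟩
  · intro z
    have hsum : ∑ i, e i ^ 2 = 1 := by
      rw [← EuclideanSpace.real_norm_sq_eq, he, one_pow]
    have hterm : ∀ (i : Fin d) (t : ℝ),
        inner ℝ (z + EuclideanSpace.single i t) e = inner ℝ z e + t * e i := by
      intro i t
      rw [inner_add_left, EuclideanSpace.inner_single_left]
      simp
    simp only [nbrSum, add_sub_right_comm, norm_add_single_sq, hterm]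
    calc _ = ∑ i : Fin d, (2 * (3 * d * R * (L + 1 - inner ℝ z e)
            - d * (L + 1 - inner ℝ z e) ^ 2 + ‖z - x‖ ^ 2) + 2 - 2 * d * e i ^ 2) :=
          Finset.sum_congr rfl fun i _ => by ring
      _ = _ := by
          rw [Finset.sum_sub_distrib, ← Finset.mul_sum, hsum]
          simp
          ring
  · intro z hz hzx
    have h1 : inner ℝ z e ≤ ‖z‖ := by
      simpa [he] using real_inner_le_norm z e
    have h2 : inner ℝ (x - z) e ≤ ‖z - x‖ := by
      simpa [he, norm_sub_rev] using real_inner_le_norm (x - z) e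
    rw [inner_sub_left, hxe] at h2
    have h3 : 0 ≤ (L + 1 - inner ℝ z e) * (3 * R - (L + 1 - inner ℝ z e)) :=
      mul_nonneg (by linarith) (by linarith)
    have := mul_nonneg hd0 h3
    nlinarith
  · simp only [hxe, sub_self, norm_zero]
    nlinarith [mul_nonneg hd0 (sq_nonneg (L + 1 - ‖x‖))]

/-- The inclusion of `ℤ^d` in Euclidean space. -/
noncomputable def latticeEmb {d : ℕ} (z : Fin d → ℤ) : EuclideanSpace ℝ (Fin d) :=
  WithLp.toLp 2 fun i => (z i : ℝ)

theorem znorm_eq_norm_latticeEmb {d : ℕ} (z : Fin d → ℤ) : znorm z = ‖latticeEmb z‖ := by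
  simp [znorm, latticeEmb, EuclideanSpace.norm_eq]

theorem latticeEmb_sub {d : ℕ} (x y : Fin d → ℤ) :
    latticeEmb (x - y) = latticeEmb x - latticeEmb y := by
  ext i; simp [latticeEmb]

theorem latticeEmb_add_single {d : ℕ} (z : Fin d → ℤ) (i : Fin d) (t : ℤ) :
    latticeEmb (z + Pi.single i t) = latticeEmb z + EuclideanSpace.single i (t : ℝ) := by
  ext j
  by_cases h : j = i
  · subst h; simp [latticeEmb]
  · simp [latticeEmb, h]

theorem exists_single_of_znorm_eq_one {d : ℕ} {v : Fin d → ℤ} (hv : znorm v = 1) :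
    ∃ i, v = Pi.single i 1 ∨ v = Pi.single i (-1) := by
  have hsum : ∑ i, v i ^ 2 = 1 := by
    have : ∑ i, (v i : ℝ) ^ 2 = 1 := by
      rw [znorm, Real.sqrt_eq_one] at hv
      exact hv
    exact_mod_cast this
  obtain ⟨i, hi⟩ : ∃ i, v i ≠ 0 := by
    by_contra! h
    simp [h] at hsum
  have hle : 0 < v i ^ 2 := by positivity
  have hsplit := Finset.add_sum_erase Finset.univ (fun j => v j ^ 2) (Finset.mem_univ i)
  have hrest : 0 ≤ ∑ j ∈ Finset.univ.erase i, v j ^ 2 :=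
    Finset.sum_nonneg fun j _ => sq_nonneg _
  have hzero : ∀ j, j ≠ i → v j = 0 := fun j hj => by
    have h0 : ∑ j ∈ Finset.univ.erase i, v j ^ 2 = 0 := by omega
    have := (Finset.sum_eq_zero_iff_of_nonneg fun j _ => sq_nonneg (v j)).1 h0 j (by simp [hj])
    exact pow_eq_zero_iff two_ne_zero |>.1 this
  have hvi : v i ^ 2 = 1 := by omega
  have hv' : v = Pi.single i (v i) := by
    ext j
    by_cases hj : j = i
    · subst hj; simp
    · simp [hzero j hj, hj]
  rcases (by simpa using hvi : v i = 1 ∨ v i = -1) with h | h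
  · exact ⟨i, Or.inl (h ▸ hv')⟩
  · exact ⟨i, Or.inr (h ▸ hv')⟩

theorem znorm_single {d : ℕ} (i : Fin d) {t : ℤ} (ht : |t| = 1) :
    znorm (Pi.single i t : Fin d → ℤ) = 1 := by
  have h := latticeEmb_add_single (0 : Fin d → ℤ) i t
  have h0 : latticeEmb (0 : Fin d → ℤ) = 0 := by ext; simp [latticeEmb]
  rw [h0, zero_add, zero_add] at h
  rw [znorm_eq_norm_latticeEmb, h, PiLp.norm_single, Real.norm_eq_abs]
  exact_mod_cast ht

/-- Discrete comparison principle, by induction on the number of steps. -/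
theorem le_of_superharmonic {d : ℕ} (hd : 0 < d) {u : ℕ → (Fin d → ℤ) → ℝ}
    {S : Set (Fin d → ℤ)} {h : EuclideanSpace ℝ (Fin d) → ℝ}
    (hu₀ : ∀ z ∈ S, u 0 z ≤ h (latticeEmb z))
    (hu : ∀ n, ∀ z ∈ S, 2 * d * u (n + 1) z ≤
      ∑ i, (u n (z + Pi.single i 1) + u n (z + Pi.single i (-1))))
    (hh : ∀ z ∈ S, nbrSum h (latticeEmb z) ≤ 2 * d * h (latticeEmb z))
    (hbd : ∀ n, ∀ z ∈ S, ∀ w, znorm (w - z) = 1 → w ∉ S → u n w ≤ h (latticeEmb w))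
    (n : ℕ) : ∀ z ∈ S, u n z ≤ h (latticeEmb z) := by
  induction n with
  | zero => exact hu₀
  | succ n ih =>
    intro z hz
    have hnbr : ∀ i : Fin d, ∀ t : ℤ, |t| = 1 →
        u n (z + Pi.single i t) ≤ h (latticeEmb z + EuclideanSpace.single i (t : ℝ)) := by
      intro i t ht
      rw [← latticeEmb_add_single]
      by_cases hw : z + Pi.single i t ∈ S
      · exact ih _ hw
      · exact hbd n z hz _ (by rw [add_sub_cancel_left]; exact znorm_single i ht) hw
    have key : 2 * d * u (n + 1) z ≤ 2 * d * h (latticeEmb z) := by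
      refine (hu n z hz).trans (le_trans ?_ (hh z hz))
      refine Finset.sum_le_sum fun i _ => add_le_add ?_ ?_
      · simpa using hnbr i 1 (by simp)
      · simpa using hnbr i (-1) (by simp)
    have hd' : (0 : ℝ) < d := by exact_mod_cast hd
    exact le_of_mul_le_mul_left key (by positivity)

/-- The event that a path enters `B` within `n` steps, staying in `V` until then. -/
def hitsWithin {S : Type*} (V B : Set S) (n : ℕ) : Set (ℕ → S) :=
  {ω | ∃ m ≤ n, ω m ∈ B ∧ ∀ k < m, ω k ∈ V}

theorem measurableSet_hitsWithin {S : Type*} [MeasurableSpace S] [Countable S]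
    [MeasurableSingletonClass S] (V B : Set S) (n : ℕ) : MeasurableSet (hitsWithin V B n) := by
  have h : ∀ (k : ℕ) (A : Set S), MeasurableSet {ω : ℕ → S | ω k ∈ A} := fun k A =>
    measurable_pi_apply k A.to_countable.measurableSet
  have : hitsWithin V B n = ⋃ m ∈ Set.Iic n, ({ω | ω m ∈ B} ∩ ⋂ k ∈ Set.Iio m, {ω | ω k ∈ V}) := by
    ext ω
    simp only [hitsWithin, Set.mem_ofPred_eq, Set.mem_iUnion, Set.mem_inter_iff, Set.mem_iInter,
      Set.mem_Iic, Set.mem_Iio, exists_prop]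
  rw [this]
  exact MeasurableSet.biUnion (Set.to_countable _) fun m _ => (h m B).inter
    (MeasurableSet.biInter (Set.to_countable _) fun k _ => h k V)

theorem ae_start {S : Type*} [MeasurableSpace S] [Countable S] [MeasurableSingletonClass S]
    {P : S → Measure (ℕ → S)} (hP : IsMarkovChain P) (z : S) : ∀ᵐ ω ∂P z, ω 0 = z := by
  have := hP.1 z
  have hmeas : MeasurableSet {ω : ℕ → S | ω 0 ∈ ({z} : Set S)} :=
    measurable_pi_apply 0 (measurableSet_singleton z)
  simp only [Set.mem_singleton_iff] at hmeas
  exact (prob_compl_eq_zero_iff hmeas).2 (hP.2.1 z)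

theorem hitsWithin_zero_eq_zero {S : Type*} [MeasurableSpace S] [Countable S]
    [MeasurableSingletonClass S] {P : S → Measure (ℕ → S)} (hP : IsMarkovChain P)
    (V : Set S) {B : Set S} {z : S} (hz : z ∉ B) : P z (hitsWithin V B 0) = 0 := by
  refine measure_mono_null (fun ω hω => ?_) (ae_start hP z)
  obtain ⟨m, hm, hB, -⟩ := hω
  obtain rfl : m = 0 := by omega
  rintro (rfl : ω 0 = z)
  exact hz hB

theorem hitsWithin_eq_zero {S : Type*} [MeasurableSpace S] [Countable S]
    [MeasurableSingletonClass S] {P : S → Measure (ℕ → S)} (hP : IsMarkovChain P)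
    {V B : Set S} {z : S} (hzB : z ∉ B) (hzV : z ∉ V) (n : ℕ) : P z (hitsWithin V B n) = 0 := by
  refine measure_mono_null (fun ω hω => ?_) (ae_start hP z)
  obtain ⟨m, hm, hB, hV⟩ := hω
  rintro (rfl : ω 0 = z)
  rcases Nat.eq_zero_or_pos m with rfl | hm0
  · exact hzB hB
  · exact hzV (hV 0 hm0)

theorem hitsWithin_succ_le {S : Type*} [MeasurableSpace S] [Countable S]
    [MeasurableSingletonClass S] {P : S → Measure (ℕ → S)} (hP : IsMarkovChain P)
    (V : Set S) {B : Set S} {z : S} (hz : z ∉ B) (n : ℕ) :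
    P z (hitsWithin V B (n + 1)) ≤ ∑' w, P w (hitsWithin V B n) * P z {ω | ω 1 = w} := by
  have hmk := hP.2.2 z 1 Set.univ (hitsWithin V B n) MeasurableSet.univ
    (measurableSet_hitsWithin V B n) (by simp)
  have hmeas : Measurable fun w => P w (hitsWithin V B n) := measurable_of_countable _
  rw [Measure.restrict_univ, Set.univ_inter,
    ← lintegral_map (μ := P z) hmeas (measurable_pi_apply 1), lintegral_countable'] at hmk
  calc P z (hitsWithin V B (n + 1)) ≤ P z {ω | (fun k => ω (1 + k)) ∈ hitsWithin V B n} := by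
        refine measure_mono_ae ?_
        filter_upwards [ae_start hP z] with ω hω hhit
        obtain ⟨m, hm, hB, hV⟩ := hhit
        have hm0 : m ≠ 0 := by
          rintro rfl
          exact hz (hω ▸ hB)
        obtain ⟨m, rfl⟩ := Nat.exists_eq_add_of_le (Nat.one_le_iff_ne_zero.2 hm0)
        exact ⟨m, by omega, hB, fun k hk => hV (1 + k) (by omega)⟩
    _ = _ := hmk
    _ = _ := by
        refine tsum_congr fun w => ?_
        rw [Measure.map_apply (measurable_pi_apply 1) (measurableSet_singleton w)]
        rfl

theorem srw_hitsWithin_succ_le {d : ℕ} (hd : 0 < d)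
    {P : (Fin d → ℤ) → Measure (ℕ → Fin d → ℤ)} (hP : IsSRW d P)
    (V : Set (Fin d → ℤ)) {B : Set (Fin d → ℤ)} {z : Fin d → ℤ} (hz : z ∉ B) (n : ℕ) :
    2 * d * (P z).real (hitsWithin V B (n + 1)) ≤
      ∑ i, ((P (z + Pi.single i 1)).real (hitsWithin V B n) +
        (P (z + Pi.single i (-1))).real (hitsWithin V B n)) := by
  classical
  have hprob := hP.1.1
  have h := hitsWithin_succ_le hP.1 V hz n
  set q : (Fin d → ℤ) → ENNReal := fun w => P w (hitsWithin V B n) with hq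
  set N : Finset (Fin d → ℤ) :=
    Finset.univ.image (fun j : Fin d × Bool => z + Pi.single j.1 (if j.2 then 1 else -1)) with hN
  have hsupp : ∀ w ∉ N, q w * P z {ω | ω 1 = w} = 0 := by
    intro w hw
    rw [hP.2, if_neg, mul_zero]
    intro h1
    obtain ⟨i, hi | hi⟩ := exists_single_of_znorm_eq_one h1
    · exact hw (Finset.mem_image.2 ⟨(i, true), Finset.mem_univ _, by simp [← hi]⟩)
    · exact hw (Finset.mem_image.2 ⟨(i, false), Finset.mem_univ _, by simp [← hi]⟩)
  have h2 : P z (hitsWithin V B (n + 1)) ≤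
      (∑ i, (q (z + Pi.single i 1) + q (z + Pi.single i (-1)))) *
        ENNReal.ofReal (1 / (2 * d)) := by
    refine h.trans ?_
    rw [tsum_eq_sum hsupp]
    calc _ ≤ ∑ w ∈ N, q w * ENNReal.ofReal (1 / (2 * d)) := by
          refine Finset.sum_le_sum fun w _ => ?_
          rw [hP.2]
          gcongr
          split_ifs <;> simp
      _ ≤ ∑ j : Fin d × Bool, q (z + Pi.single j.1 (if j.2 then 1 else -1)) *
            ENNReal.ofReal (1 / (2 * d)) := Finset.sum_image_le_of_nonneg (by simp)
      _ = _ := by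
          rw [← Finset.sum_mul, Fintype.sum_prod_type]
          simp
  have hfin : ∀ w, q w ≠ ⊤ := fun w => measure_ne_top _ _
  have hd' : (0 : ℝ) < d := by exact_mod_cast hd
  have h3 := ENNReal.toReal_mono (ENNReal.mul_ne_top
    (ENNReal.sum_ne_top.2 fun i _ => ENNReal.add_ne_top.2 ⟨hfin _, hfin _⟩)
    ENNReal.ofReal_ne_top) h2
  rw [ENNReal.toReal_mul, ENNReal.toReal_ofReal (by positivity),
    ENNReal.toReal_sum fun i _ => ENNReal.add_ne_top.2 ⟨hfin _, hfin _⟩] at h3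
  simp only [ENNReal.toReal_add (hfin _) (hfin _)] at h3
  rw [mul_one_div, le_div_iff₀ (by positivity), mul_comm] at h3
  exact h3

theorem measure_hits_le {S : Type*} [MeasurableSpace S] {P : S → Measure (ℕ → S)}
    (hP : IsMarkovChain P) {V B : Set S} {z : S} {b : ℝ}
    (hb : ∀ n, (P z).real (hitsWithin V B n) ≤ b) :
    P z {ω | ∃ n, ω n ∈ B ∧ ∀ k < n, ω k ∈ V} ≤ ENNReal.ofReal b := by
  have := hP.1 z
  have hmono : Monotone (hitsWithin V B) := fun n m hnm ω ⟨k, hk, h⟩ => ⟨k, hk.trans hnm, h⟩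
  have heq : {ω : ℕ → S | ∃ n, ω n ∈ B ∧ ∀ k < n, ω k ∈ V} = ⋃ n, hitsWithin V B n := by
    ext ω
    simp only [hitsWithin, Set.mem_iUnion, Set.mem_ofPred_eq]
    exact ⟨fun ⟨n, h⟩ => ⟨n, n, le_rfl, h⟩, fun ⟨_, n, _, h⟩ => ⟨n, h⟩⟩
  rw [heq, hmono.measure_iUnion]
  exact iSup_le fun n => (ENNReal.le_ofReal_iff_toReal_le (measure_ne_top _ _)
    (measureReal_nonneg.trans (hb 0))).2 (hb n)

theorem srw_hitsWithin_le_dipole {d : ℕ} (hd : 3 ≤ d)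
    {P : (Fin d → ℤ) → Measure (ℕ → Fin d → ℤ)} (hP : IsSRW d P) :
    ∃ K > (0 : ℝ), ∀ (L a : ℝ) (y : Fin d → ℤ), 1 ≤ a → ∀ (n : ℕ) (z : Fin d → ℤ),
      0 < znorm (z - y) →
      (P z).real (hitsWithin {w | znorm w ≤ L} {w | znorm (w - y) ≤ a} n) ≤
        K * a ^ (d - 2) * max a (L - znorm y) / znorm (z - y) ^ (d - 1) := by
  obtain ⟨r₀, K, hr₀, hK, h⟩ := exists_dipole_barrier hd
  refine ⟨K + r₀ ^ (d - 1), by positivity, ?_⟩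
  intro L a y ha n z hz
  have hprob := hP.1.1
  set V : Set (Fin d → ℤ) := {w | znorm w ≤ L} with hV
  set B : Set (Fin d → ℤ) := {w | znorm (w - y) ≤ a} with hB
  set D := max a (L - znorm y) with hD
  have haD : a ≤ D := le_max_left _ _
  have hD0 : 0 < D := by linarith
  rcases le_or_gt (znorm (z - y)) (r₀ * a) with hza | hza
  · refine measureReal_le_one.trans ?_
    rw [le_div_iff₀ (by positivity), one_mul]
    calc znorm (z - y) ^ (d - 1) ≤ (r₀ * a) ^ (d - 1) := by gcongr
      _ = r₀ ^ (d - 1) * a ^ (d - 2) * a := by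
          rw [mul_pow, show d - 1 = d - 2 + 1 by omega, pow_succ a]; ring
      _ ≤ (K + r₀ ^ (d - 1)) * a ^ (d - 2) * D := by
          gcongr
          linarith
  have hBS : ∀ w, r₀ * a < znorm (w - y) → w ∉ B := by
    intro w hw hwB
    have : znorm (w - y) ≤ a := hwB
    nlinarith
  by_cases hzV : z ∈ V
  swap
  · rw [measureReal_def, hitsWithin_eq_zero hP.1 (hBS z hza) hzV, ENNReal.toReal_zero]
    positivity
  obtain ⟨F, hF1, hF2, hF3, hF4⟩ := h a D L (latticeEmb y) ha haD
    (by rw [← znorm_eq_norm_latticeEmb]; exact le_max_right _ _)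
  have hnorm : ∀ w : Fin d → ℤ, ‖latticeEmb w - latticeEmb y‖ = znorm (w - y) := fun w => by
    rw [← latticeEmb_sub, znorm_eq_norm_latticeEmb]
  have hF2' : ∀ w : Fin d → ℤ, znorm w ≤ L + 1 → r₀ * a - 1 ≤ znorm (w - y) →
      0 ≤ F (latticeEmb w) := fun w h1 h2 =>
    hF2 _ (by rwa [← znorm_eq_norm_latticeEmb]) (by rwa [hnorm])
  have hle : (P z).real (hitsWithin V B n) ≤ F (latticeEmb z) := by
    refine le_of_superharmonic (u := fun n z => (P z).real (hitsWithin V B n))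
      (S := {w | w ∈ V ∧ r₀ * a < znorm (w - y)}) (by omega) ?_ ?_ ?_ ?_ n z ⟨hzV, hza⟩
    · rintro w ⟨hwV, hw⟩
      simp only [measureReal_def]
      rw [hitsWithin_zero_eq_zero hP.1 V (hBS w hw), ENNReal.toReal_zero]
      exact hF2' w (by have : znorm w ≤ L := hwV; linarith) (by linarith)
    · rintro n w ⟨hwV, hw⟩
      exact srw_hitsWithin_succ_le (by omega) hP V (hBS w hw) n
    · rintro w ⟨hwV, hw⟩
      exact hF1 _ (by rw [← znorm_eq_norm_latticeEmb]; exact hwV) (by rwa [hnorm])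
    · rintro n w ⟨hwV, hw⟩ v hvw hv
      have hvL : znorm v ≤ L + 1 := by
        have h1 : znorm w ≤ L := hwV
        have h2 := norm_le_norm_add_norm_sub' (latticeEmb v) (latticeEmb w)
        rw [← latticeEmb_sub, ← znorm_eq_norm_latticeEmb, ← znorm_eq_norm_latticeEmb,
          ← znorm_eq_norm_latticeEmb, hvw] at h2
        linarith
      have hvy : r₀ * a - 1 ≤ znorm (v - y) := by
        have h2 := norm_le_norm_add_norm_sub (latticeEmb (v - y)) (latticeEmb (w - y))
        rw [← latticeEmb_sub, ← znorm_eq_norm_latticeEmb, ← znorm_eq_norm_latticeEmb,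
          ← znorm_eq_norm_latticeEmb, sub_sub_sub_cancel_right, hvw] at h2
        linarith
      rcases le_or_gt (znorm (v - y)) (r₀ * a) with hva | hva
      · exact measureReal_le_one.trans (hF3 _ (by rwa [← znorm_eq_norm_latticeEmb])
          (by rwa [hnorm]) (by rwa [hnorm]))
      · have hvV : v ∉ V := fun h => hv ⟨h, hva⟩
        simp only [measureReal_def]
        rw [hitsWithin_eq_zero hP.1 (hBS v hva) hvV, ENNReal.toReal_zero]
        exact hF2' v hvL hvy
  refine hle.trans ((hF4 _ ?_ ?_).trans ?_)
  · rw [← znorm_eq_norm_latticeEmb]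
    have : znorm z ≤ L := hzV
    linarith
  · rw [hnorm]; linarith
  · rw [hnorm]
    gcongr
    have : 0 < r₀ ^ (d - 1) := by positivity
    linarith

/-- For `d ≥ 3` there is a constant `C > 0` (independent of `a, L, x, y`)
such that whenever `a ≥ 1`, `|x-y| > 7a` and `V_a(y) ⊆ V_L`, simple random walk started at
`x` hits `V_a(y)` before exiting `V_L` with probability at most
`C a^{d-2} max(a, d_L(y)) max(1, d_L(x)) / |x-y|^d`. -/
theorem stmt9 (d : ℕ) (hd : 3 ≤ d)
    (P : (Fin d → ℤ) → Measure (ℕ → Fin d → ℤ)) (hP : IsSRW d P) :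
    ∃ C > (0 : ℝ), ∀ (L a : ℝ) (x y : Fin d → ℤ), 1 ≤ a → 7 * a < znorm (x - y) →
      (∀ z : Fin d → ℤ, znorm (z - y) ≤ a → znorm z ≤ L) →
      P x {ω | ∃ n : ℕ, znorm (ω n - y) ≤ a ∧ ∀ k < n, znorm (ω k) ≤ L}
        ≤ ENNReal.ofReal (C * a ^ (d - 2) * max a (L - znorm y) * max 1 (L - znorm x)
            / znorm (x - y) ^ d) := by
  obtain ⟨K, hK, hdip⟩ := srw_hitsWithin_le_dipole hd hP
  have hd0 : (3 : ℝ) ≤ d := by exact_mod_cast hd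
  refine ⟨24 * d * 3 ^ (d - 1) * K, by positivity, ?_⟩
  intro L a x y ha hxy _
  refine measure_hits_le (V := {w | znorm w ≤ L}) (B := {w | znorm (w - y) ≤ a}) hP.1 fun n => ?_
  have hprob := hP.1.1
  have hdip' := hdip L a y ha
  set V : Set (Fin d → ℤ) := {w | znorm w ≤ L} with hV
  set B : Set (Fin d → ℤ) := {w | znorm (w - y) ≤ a} with hB
  set D := max a (L - znorm y) with hD
  set D' := max 1 (L - znorm x) with hD'
  set R := znorm (x - y) with hR
  have hD1 : 1 ≤ D := ha.trans (le_max_left _ _)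
  have hD'1 : 1 ≤ D' := le_max_left _ _
  have hR7 : 7 < R := by linarith
  have hδ : L + 1 - znorm x ≤ 2 * D' := by
    have : L - znorm x ≤ D' := le_max_right _ _
    linarith
  have hxB : x ∉ B := fun h => by
    have : R ≤ a := h
    linarith
  by_cases hxV : x ∈ V
  swap
  · rw [measureReal_def, hitsWithin_eq_zero hP.1 hxB hxV, ENNReal.toReal_zero]
    positivity
  have hxL : znorm x ≤ L := hxV
  have hRd : R ^ d = R ^ (d - 1) * R := by rw [← pow_succ]; congr 1; omega
  rcases le_or_gt (L + 1 - znorm x) R with hδR | hδR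
  swap
  · refine (hdip' n x (by linarith)).trans ?_
    rw [hRd, div_le_div_iff₀ (by positivity) (by positivity)]
    have h3 : (1 : ℝ) ≤ 3 ^ (d - 1) := one_le_pow₀ (by norm_num)
    have h24 : R ≤ 24 * d * 3 ^ (d - 1) * D' := by
      have : (24 : ℝ) * 3 * 1 * D' ≤ 24 * d * 3 ^ (d - 1) * D' := by gcongr
      linarith
    calc K * a ^ (d - 2) * D * (R ^ (d - 1) * R)
        ≤ K * a ^ (d - 2) * D * (R ^ (d - 1) * (24 * d * 3 ^ (d - 1) * D')) := by gcongr
      _ = _ := by ring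
  have htri : ∀ v w : Fin d → ℤ, znorm v ≤ znorm w + znorm (v - w) := fun v w => by
    simp only [znorm_eq_norm_latticeEmb, latticeEmb_sub]
    exact norm_le_norm_add_norm_sub' _ _
  have hsymm : ∀ v w : Fin d → ℤ, znorm (v - w) = znorm (w - v) := fun v w => by
    simp only [znorm_eq_norm_latticeEmb, latticeEmb_sub]
    exact norm_sub_rev _ _
  have hnorm : ∀ v w : Fin d → ℤ, ‖latticeEmb v - latticeEmb w‖ = znorm (v - w) := fun v w => by
    rw [← latticeEmb_sub, znorm_eq_norm_latticeEmb]
  obtain ⟨b, hb1, hb2, hb3⟩ := exists_quadratic_barrier (d := d) (by omega) (L := L) (R := R)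
    (latticeEmb x) (by rw [← znorm_eq_norm_latticeEmb]; linarith)
    (by rwa [← znorm_eq_norm_latticeEmb])
  rw [← znorm_eq_norm_latticeEmb] at hb3
  have hb2' : ∀ w : Fin d → ℤ, znorm w ≤ L + 1 → znorm (w - x) ≤ R →
      znorm (w - x) ^ 2 ≤ b (latticeEmb w) := fun w h1 h2 => by
    have := hb2 (latticeEmb w) (by rwa [← znorm_eq_norm_latticeEmb]) (by rwa [hnorm])
    rwa [hnorm] at this
  have hfar : ∀ w : Fin d → ℤ, znorm (w - x) ≤ R / 2 + 1 → R / 3 ≤ znorm (w - y) := by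
    intro w hw
    have := htri (x - y) (w - y)
    rw [sub_sub_sub_cancel_right, hsymm x w] at this
    linarith
  have hfarB : ∀ w : Fin d → ℤ, znorm (w - x) ≤ R / 2 + 1 → w ∉ B := by
    intro w hw hwB
    have h1 : znorm (w - y) ≤ a := hwB
    have h2 := hfar w hw
    linarith
  set M := K * a ^ (d - 2) * D / (R / 3) ^ (d - 1) with hM
  have hM0 : 0 < M := by positivity
  have hle : (P x).real (hitsWithin V B n) ≤ M * (4 / R ^ 2) * b (latticeEmb x) := by
    refine le_of_superharmonic (u := fun n z => (P z).real (hitsWithin V B n))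
      (S := {w | w ∈ V ∧ znorm (w - x) ≤ R / 2}) (h := fun z => M * (4 / R ^ 2) * b z)
      (by omega) ?_ ?_ ?_ ?_ n x ⟨hxV, ?_⟩
    · rintro w ⟨hwV, hw⟩
      simp only [measureReal_def]
      rw [hitsWithin_zero_eq_zero hP.1 V (hfarB w (by linarith)), ENNReal.toReal_zero]
      have hwL : znorm w ≤ L := hwV
      have := (sq_nonneg _).trans (hb2' w (by linarith) (by linarith))
      positivity
    · rintro n w ⟨hwV, hw⟩
      exact srw_hitsWithin_succ_le (by omega) hP V (hfarB w (by linarith)) n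
    · rintro w -
      rw [nbrSum_const_mul, hb1]
      exact le_of_eq (by ring)
    · rintro n w ⟨hwV, hw⟩ v hvw hv
      have hwL : znorm w ≤ L := hwV
      have hvL : znorm v ≤ L + 1 := by
        have := htri v w
        linarith
      have hvx : znorm (v - x) ≤ R / 2 + 1 := by
        have := htri (v - x) (w - x)
        rw [sub_sub_sub_cancel_right] at this
        linarith
      have hbv := hb2' v hvL (by linarith)
      rcases le_or_gt (znorm (v - x)) (R / 2) with hva | hva
      · have hvV : v ∉ V := fun h => hv ⟨h, hva⟩
        simp only [measureReal_def]
        rw [hitsWithin_eq_zero hP.1 (hfarB v hvx) hvV, ENNReal.toReal_zero]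
        have := (sq_nonneg _).trans hbv
        positivity
      · have hvy := hfar v hvx
        have hbR : (R / 2) ^ 2 ≤ b (latticeEmb v) := le_trans (by gcongr) hbv
        calc (P v).real (hitsWithin V B n)
            ≤ K * a ^ (d - 2) * D / znorm (v - y) ^ (d - 1) := hdip' n v (by linarith)
          _ ≤ M := by rw [hM]; gcongr
          _ = M * (4 / R ^ 2) * (R / 2) ^ 2 := by field_simp; ring
          _ ≤ M * (4 / R ^ 2) * b (latticeEmb v) := by gcongr
    · rw [sub_self, znorm_eq_norm_latticeEmb, ← sub_self x, latticeEmb_sub, sub_self, norm_zero]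
      linarith
  calc (P x).real (hitsWithin V B n) ≤ M * (4 / R ^ 2) * (3 * d * R * (2 * D')) :=
        hle.trans (by gcongr; exact hb3.trans (by gcongr))
    _ = _ := by
        rw [hM, hRd, div_pow]
        field_simp
        ring
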